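/- Let Φ be an m×N complex matrix with δ_{3s}(Φ) ≤ δ_{4s}(Φ) ≤ 0.1. Let x ∈ ℂ^N be s-sparse, let e ∈ ℂ^m, and let u = Φx + e. Let T be a set of at most 3s indices, and define b ∈ ℂ^N by b|_T = Φ_T† u and b|_{T^c} = 0. Then ‖x − b‖₂ ≤ 1.112·‖x|_{T^c}‖₂ + 1.06·‖e‖₂. -/

import Mathlib

open Matrix
open scoped BigOperators Classical

/-- The Euclidean (ℓ₂) norm of a finitely indexed complex vector. -/
noncomputable def l2 {ι : Type*} [Fintype ι] (x : ι → ℂ) : ℝ :=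
  Real.sqrt (∑ i, ‖x i‖ ^ 2)

/-- The ℓ₁ norm of a finitely indexed complex vector. -/
noncomputable def l1 {ι : Type*} [Fintype ι] (x : ι → ℂ) : ℝ := ∑ i, ‖x i‖

/-- The ℓ∞ (supremum) norm of a finitely indexed complex vector. -/
noncomputable def linf {ι : Type*} [Fintype ι] (x : ι → ℂ) : ℝ := ⨆ i, ‖x i‖

/-- The support of a vector, as a finite set of coordinates. -/
noncomputable def suppF {N : ℕ} (x : Fin N → ℂ) : Finset (Fin N) :=
  Finset.univ.filter fun i => x i ≠ 0

/-- A vector is `s`-sparse when it has at most `s` nonzero entries. -/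
def Sparse {N : ℕ} (s : ℕ) (x : Fin N → ℂ) : Prop := (suppF x).card ≤ s

/-- Restriction of a vector to a set `T` of coordinates: equal to `x` on `T`, zero off `T`. -/
noncomputable def restrictTo {N : ℕ} (x : Fin N → ℂ) (T : Finset (Fin N)) : Fin N → ℂ :=
  fun i => if i ∈ T then x i else 0

/-- `y` is a best `s`-sparse approximation of `x`: it agrees with `x` on a set of `s`
coordinates of largest magnitude and vanishes elsewhere. -/
def IsSparseApprox {N : ℕ} (s : ℕ) (x y : Fin N → ℂ) : Prop :=
  ∃ T : Finset (Fin N), T.card = min s N ∧ y = restrictTo x T ∧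
    ∀ i ∈ T, ∀ j ∉ T, ‖x j‖ ≤ ‖x i‖

/-- The `r`-th restricted isometry constant of `Φ`: the least `δ ≥ 0` such that
`(1-δ)‖x‖² ≤ ‖Φx‖² ≤ (1+δ)‖x‖²` for all `r`-sparse `x`. -/
noncomputable def RIC {m N : ℕ} (Φ : Matrix (Fin m) (Fin N) ℂ) (r : ℕ) : ℝ :=
  sInf {δ : ℝ | 0 ≤ δ ∧ ∀ x : Fin N → ℂ, Sparse r x →
    (1 - δ) * l2 x ^ 2 ≤ l2 (Φ.mulVec x) ^ 2 ∧ l2 (Φ.mulVec x) ^ 2 ≤ (1 + δ) * l2 x ^ 2}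

/-- The column submatrix of `Φ` with columns indexed by the finite set `T`. -/
noncomputable def colSub {m N : ℕ} (Φ : Matrix (Fin m) (Fin N) ℂ) (T : Finset (Fin N)) :
    Matrix (Fin m) {i // i ∈ T} ℂ :=
  Matrix.of fun r c => Φ r c.1

/-- The least-squares estimate `Φ_T† u = (Φ_T* Φ_T)⁻¹ Φ_T* u`, viewed as a vector in `ℂ^N`
supported on `T`. -/
noncomputable def pinvApply {m N : ℕ} (Φ : Matrix (Fin m) (Fin N) ℂ) (T : Finset (Fin N))
    (u : Fin m → ℂ) : Fin N → ℂ :=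
  fun j =>
    if h : j ∈ T then (((colSub Φ T)ᴴ * colSub Φ T)⁻¹ * (colSub Φ T)ᴴ).mulVec u ⟨j, h⟩
    else 0

/-- One iteration of CoSaMP with samples `u` and sparsity level `s`, mapping the current
approximation `a` to the next approximation `a'`. -/
def CoSaMPStep {m N : ℕ} (Φ : Matrix (Fin m) (Fin N) ℂ) (u : Fin m → ℂ) (s : ℕ)
    (a a' : Fin N → ℂ) : Prop :=
  ∃ y2s : Fin N → ℂ,
    IsSparseApprox (2 * s) (Φᴴ.mulVec (u - Φ.mulVec a)) y2s ∧
    IsSparseApprox s (pinvApply Φ (suppF y2s ∪ suppF a) u) a'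

/-- `a` is a sequence of approximations produced by CoSaMP: `a 0 = 0` and each successive
approximation arises from one CoSaMP iteration. -/
def CoSaMPSeq {m N : ℕ} (Φ : Matrix (Fin m) (Fin N) ℂ) (u : Fin m → ℂ) (s : ℕ)
    (a : ℕ → Fin N → ℂ) : Prop :=
  a 0 = 0 ∧ ∀ k, CoSaMPStep Φ u s (a k) (a (k + 1))

/-- The spectral norm (ℓ₂ → ℓ₂ operator norm) of a matrix. -/
noncomputable def specNorm {a b : Type*} [Fintype a] [Fintype b] (M : Matrix a b ℂ) : ℝ :=
  sSup ((fun x => l2 (M.mulVec x)) '' {x | l2 x ≤ 1})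

section Norm

variable {ι : Type*} [Fintype ι]

theorem l2_eq_norm_toLp (x : ι → ℂ) : l2 x = ‖WithLp.toLp 2 x‖ := by
  rw [EuclideanSpace.norm_eq, l2]

theorem l2_nonneg (x : ι → ℂ) : 0 ≤ l2 x := Real.sqrt_nonneg _

theorem l2_add_le (x y : ι → ℂ) : l2 (x + y) ≤ l2 x + l2 y := by
  simpa only [l2_eq_norm_toLp, WithLp.toLp_add] using norm_add_le _ _

theorem l2_sq (x : ι → ℂ) : l2 x ^ 2 = ∑ i, ‖x i‖ ^ 2 :=
  Real.sq_sqrt (by positivity)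

theorem l2_sq_eq_re_dotProduct (x : ι → ℂ) : l2 x ^ 2 = (star x ⬝ᵥ x).re := by
  simp [l2_sq, dotProduct, Complex.sq_norm, Complex.normSq_apply]

theorem abs_re_star_dotProduct_le (x y : ι → ℂ) : |(star x ⬝ᵥ y).re| ≤ l2 x * l2 y := by
  have h := norm_inner_le_norm (𝕜 := ℂ) (WithLp.toLp 2 x) (WithLp.toLp 2 y)
  rw [EuclideanSpace.inner_toLp_toLp, dotProduct_comm] at h
  simpa only [l2_eq_norm_toLp] using (Complex.abs_re_le_norm _).trans h

theorem re_star_dotProduct_comm (x y : ι → ℂ) : (star x ⬝ᵥ y).re = (star y ⬝ᵥ x).re := by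
  rw [star_dotProduct, Complex.star_def, Complex.conj_re]

theorem l2_add_smul_sq (x y : ι → ℂ) (t : ℝ) :
    l2 (x + (t : ℂ) • y) ^ 2 =
      l2 x ^ 2 + 2 * t * (star x ⬝ᵥ y).re + t ^ 2 * l2 y ^ 2 := by
  have h := re_star_dotProduct_comm y x
  simp only [l2_sq_eq_re_dotProduct, star_add, star_smul, add_dotProduct, dotProduct_add,
    smul_dotProduct, dotProduct_smul, Complex.add_re, smul_eq_mul, Complex.star_def,
    Complex.conj_ofReal, Complex.re_ofReal_mul, h]
  ring

theorem eq_zero_of_l2_sq_nonpos {x : ι → ℂ} (h : l2 x ^ 2 ≤ 0) : x = 0 := by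
  have h0 : ‖WithLp.toLp 2 x‖ = 0 := by
    rw [← l2_eq_norm_toLp]
    exact pow_eq_zero_iff two_ne_zero |>.mp (le_antisymm h (sq_nonneg _))
  exact (WithLp.toLp_eq_zero 2).mp (norm_eq_zero.mp h0)

end Norm

section RestrictedIsometry

variable {m N : ℕ} {Φ : Matrix (Fin m) (Fin N) ℂ}

theorem Sparse.of_support_subset {x : Fin N → ℂ} {T : Finset (Fin N)} {r : ℕ}
    (h : ∀ i ∉ T, x i = 0) (hT : T.card ≤ r) : Sparse r x := by
  refine (Finset.card_le_card fun i hi => ?_).trans hT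
  by_contra hi'
  simp [suppF, h i hi'] at hi

theorem exists_l2_mulVec_sq_le (Φ : Matrix (Fin m) (Fin N) ℂ) :
    ∃ C : ℝ, 0 ≤ C ∧ ∀ x, l2 (Φ.mulVec x) ^ 2 ≤ C * l2 x ^ 2 := by
  let L := LinearMap.toContinuousLinearMap (Matrix.toLpLin 2 2 Φ)
  refine ⟨‖L‖ ^ 2, by positivity, fun x => ?_⟩
  rw [← mul_pow]
  refine pow_le_pow_left₀ (l2_nonneg _) ?_ 2
  simp only [l2_eq_norm_toLp]
  exact L.le_opNorm (WithLp.toLp 2 x)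

/-- The restricted isometry constant satisfies its defining inequalities. -/
theorem RIC_spec (Φ : Matrix (Fin m) (Fin N) ℂ) (r : ℕ) :
    0 ≤ RIC Φ r ∧ ∀ x : Fin N → ℂ, Sparse r x →
      (1 - RIC Φ r) * l2 x ^ 2 ≤ l2 (Φ.mulVec x) ^ 2 ∧
        l2 (Φ.mulVec x) ^ 2 ≤ (1 + RIC Φ r) * l2 x ^ 2 := by
  refine IsClosed.csInf_mem (s := {δ : ℝ | 0 ≤ δ ∧ ∀ x : Fin N → ℂ, Sparse r x →
    (1 - δ) * l2 x ^ 2 ≤ l2 (Φ.mulVec x) ^ 2 ∧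
      l2 (Φ.mulVec x) ^ 2 ≤ (1 + δ) * l2 x ^ 2}) ?_ ?_ ⟨0, fun δ hδ => hδ.1⟩
  · simp only [Set.ofPred_and, Set.ofPred_forall]
    refine isClosed_Ici.inter (isClosed_iInter fun x => isClosed_iInter fun _ => ?_)
    exact (isClosed_le (by fun_prop) (by fun_prop)).inter
      (isClosed_le (by fun_prop) (by fun_prop))
  · obtain ⟨C, hC, h⟩ := exists_l2_mulVec_sq_le Φ
    refine ⟨1 + C, by positivity, fun x _ => ⟨?_, ?_⟩⟩
    · nlinarith [sq_nonneg (l2 x), sq_nonneg (l2 (Φ.mulVec x)),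
        mul_nonneg hC (sq_nonneg (l2 x))]
    · nlinarith [sq_nonneg (l2 x), h x]

theorem RIC_bounds {r : ℕ} {δ : ℝ} (hδ : RIC Φ r ≤ δ) {x : Fin N → ℂ} (hx : Sparse r x) :
    (1 - δ) * l2 x ^ 2 ≤ l2 (Φ.mulVec x) ^ 2 ∧
      l2 (Φ.mulVec x) ^ 2 ≤ (1 + δ) * l2 x ^ 2 := by
  obtain ⟨h₁, h₂⟩ := (RIC_spec Φ r).2 x hx
  have h := mul_le_mul_of_nonneg_right hδ (sq_nonneg (l2 x))
  constructor <;> linarith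

/-- Restricted orthogonality: the images of vectors with disjoint supports are nearly
orthogonal. -/
theorem abs_re_mulVec_dotProduct_mulVec_le {r : ℕ} {δ : ℝ} (hδ : RIC Φ r ≤ δ)
    {S T : Finset (Fin N)} (hST : Disjoint S T) (hr : S.card + T.card ≤ r)
    {x y : Fin N → ℂ} (hx : ∀ i ∉ S, x i = 0) (hy : ∀ i ∉ T, y i = 0) :
    |(star (Φ.mulVec x) ⬝ᵥ Φ.mulVec y).re| ≤ δ * (l2 x * l2 y) := by
  have hδ0 : 0 ≤ δ := (RIC_spec Φ r).1.trans hδ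
  have hxy : (star x ⬝ᵥ y).re = 0 := by
    rw [dotProduct, Finset.sum_eq_zero, Complex.zero_re]
    intro i _
    by_cases hi : i ∈ S
    · simp [hy i (Finset.disjoint_left.mp hST hi)]
    · simp [hx i hi]
  have key (t : ℝ) :
      l2 (Φ.mulVec (x + (t : ℂ) • y)) ^ 2 ≤ (1 + δ) * (l2 x ^ 2 + t ^ 2 * l2 y ^ 2) ∧
      (1 - δ) * (l2 x ^ 2 + t ^ 2 * l2 y ^ 2) ≤ l2 (Φ.mulVec (x + (t : ℂ) • y)) ^ 2 := by
    have hs : Sparse r (x + (t : ℂ) • y) := by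
      refine Sparse.of_support_subset (T := S ∪ T) (fun i hi => ?_)
        ((Finset.card_union_le S T).trans hr)
      rw [Finset.mem_union, not_or] at hi
      simp [hx i hi.1, hy i hi.2]
    have h := RIC_bounds hδ hs
    have he : l2 (x + (t : ℂ) • y) ^ 2 = l2 x ^ 2 + t ^ 2 * l2 y ^ 2 := by
      rw [l2_add_smul_sq, hxy]; ring
    rw [he] at h
    exact h.symm
  set R := (star (Φ.mulVec x) ⬝ᵥ Φ.mulVec y).re with hR
  have hquad (t : ℝ) : 0 ≤ δ * l2 y ^ 2 * (t * t) + 2 * R * t + δ * l2 x ^ 2 := by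
    have h₁ := (key t).2
    have h₂ := (key (-t)).1
    simp only [mulVec_add, mulVec_smul, l2_add_smul_sq, ← hR] at h₁ h₂
    nlinarith
  have hdisc := discrim_le_zero hquad
  rw [discrim] at hdisc
  refine abs_le_of_sq_le_sq ?_ (by have := l2_nonneg x; have := l2_nonneg y; positivity)
  nlinarith

end RestrictedIsometry

section LeastSquares

variable {m N : ℕ} {Φ : Matrix (Fin m) (Fin N) ℂ} {T : Finset (Fin N)}

theorem mulVec_eq_colSub_mulVec {w : Fin N → ℂ} (hw : ∀ i ∉ T, w i = 0) :
    Φ.mulVec w = (colSub Φ T).mulVec fun i => w i := by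
  ext r
  simp only [mulVec, dotProduct, colSub, of_apply]
  rw [Finset.sum_coe_sort T fun i => Φ r i * w i]
  refine (Finset.sum_subset (Finset.subset_univ T) fun i _ hi => ?_).symm
  rw [hw i hi, mul_zero]

theorem pinvApply_eq_zero (u : Fin m → ℂ) : ∀ i ∉ T, pinvApply Φ T u i = 0 :=
  fun _ hi => dif_neg hi

open scoped ComplexOrder in
theorem isUnit_colSub_gram {r : ℕ} {δ : ℝ} (hδ : RIC Φ r ≤ δ) (hδ1 : δ < 1)
    (hT : T.card ≤ r) : IsUnit ((colSub Φ T)ᴴ * colSub Φ T) := by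
  rw [← mulVec_injective_iff_isUnit]
  refine (injective_iff_map_eq_zero (mulVecLin ((colSub Φ T)ᴴ * colSub Φ T))).mpr fun v hv => ?_
  rw [mulVecLin_apply, conjTranspose_mul_self_mulVec_eq_zero] at hv
  let w : Fin N → ℂ := fun i => if h : i ∈ T then v ⟨i, h⟩ else 0
  have hw : ∀ i ∉ T, w i = 0 := fun i hi => dif_neg hi
  have hwv : (fun i : {i // i ∈ T} => w i) = v := by
    ext i
    simp [w]
  have h := (RIC_bounds hδ (Sparse.of_support_subset hw hT)).1
  rw [mulVec_eq_colSub_mulVec hw, hwv, hv] at h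
  have h0 : l2 (0 : Fin m → ℂ) ^ 2 = 0 := by simp [l2_sq]
  have hw0 : w = 0 := eq_zero_of_l2_sq_nonpos (by nlinarith)
  rw [← hwv, hw0]
  rfl

/-- The normal equations: the least-squares residual is orthogonal to the columns in `T`. -/
theorem star_mulVec_dotProduct_residual
    (hG : IsUnit ((colSub Φ T)ᴴ * colSub Φ T)) (u : Fin m → ℂ)
    {w : Fin N → ℂ} (hw : ∀ i ∉ T, w i = 0) :
    star (Φ.mulVec w) ⬝ᵥ (u - Φ.mulVec (pinvApply Φ T u)) = 0 := by
  have hb : (fun i : {i // i ∈ T} => pinvApply Φ T u i) =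
      (((colSub Φ T)ᴴ * colSub Φ T)⁻¹ * (colSub Φ T)ᴴ).mulVec u := by
    ext i
    simp [pinvApply]
  rw [mulVec_eq_colSub_mulVec hw, mulVec_eq_colSub_mulVec (pinvApply_eq_zero u), hb,
    star_mulVec, ← dotProduct_mulVec, mulVec_sub, mulVec_mulVec, mulVec_mulVec,
    ← Matrix.mul_assoc,
    mul_nonsing_inv _ ((isUnit_iff_isUnit_det _).mp hG), Matrix.one_mul, sub_self,
    dotProduct_zero]

end LeastSquares

/-- **Estimation.**  Let `x` be `s`-sparse, `u = Φx + e`, and let `T` be a set of at most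
`3s` indices.  The least-squares estimate `b` with `b|_T = Φ_T† u`, `b|_{T^c} = 0`
satisfies `‖x − b‖₂ ≤ 1.112‖x|_{T^c}‖₂ + 1.06‖e‖₂`. -/
theorem estimation
    {m N : ℕ} (s : ℕ) (Φ : Matrix (Fin m) (Fin N) ℂ)
    (h34 : RIC Φ (3 * s) ≤ RIC Φ (4 * s)) (hΦ : RIC Φ (4 * s) ≤ 0.1)
    (x : Fin N → ℂ) (hx : Sparse s x) (e : Fin m → ℂ)
    (u : Fin m → ℂ) (hu : u = Φ.mulVec x + e)
    (T : Finset (Fin N)) (hT : T.card ≤ 3 * s) :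
    l2 (x - pinvApply Φ T u) ≤ 1.112 * l2 (restrictTo x Tᶜ) + 1.06 * l2 e := by
  have hcard : T.card + (suppF x \ T).card ≤ 4 * s := by
    have h : (suppF x \ T).card ≤ s := (Finset.card_le_card Finset.sdiff_subset).trans hx
    omega
  have hT' : T.card ≤ 4 * s := by omega
  set b := pinvApply Φ T u with hb
  set z := restrictTo x Tᶜ with hz
  set w := restrictTo x T - b with hw
  have hwT : ∀ i ∉ T, w i = 0 := fun i hi => by
    simp [hw, restrictTo, hi, hb, pinvApply_eq_zero u i hi]
  have hzT : ∀ i ∉ suppF x \ T, z i = 0 := fun i hi => by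
    by_cases h : i ∈ T
    · simp [hz, restrictTo, h]
    · have h0 : x i = 0 := by simpa [suppF, h] using hi
      simp [hz, restrictTo, h0]
  have hxb : x - b = w + z := by
    ext i
    by_cases h : i ∈ T <;> simp [hw, hz, restrictTo, h, neg_add_eq_sub]
  have hres : u - Φ.mulVec b = Φ.mulVec w + Φ.mulVec z + e := by
    rw [← mulVec_add, ← hxb, mulVec_sub, hu]
    abel
  have hnormal := star_mulVec_dotProduct_residual
    (isUnit_colSub_gram hΦ (by norm_num) hT') u hwT
  rw [← hb, hres, dotProduct_add, dotProduct_add] at hnormal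
  have hre := congrArg Complex.re hnormal
  rw [Complex.add_re, Complex.add_re, ← l2_sq_eq_re_dotProduct, Complex.zero_re] at hre
  have hortho := (abs_le.mp
    (abs_re_mulVec_dotProduct_mulVec_le hΦ Finset.disjoint_sdiff hcard hwT hzT)).1
  have hnoise := (abs_le.mp (abs_re_star_dotProduct_le (Φ.mulVec w) e)).1
  have hlow := (RIC_bounds hΦ (Sparse.of_support_subset hwT hT')).1
  have htri := l2_add_le w z
  rw [← hxb] at htri
  have hw0 := l2_nonneg w
  have hz0 := l2_nonneg z
  have he0 := l2_nonneg e
  have hA0 := l2_nonneg (Φ.mulVec w)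
  generalize l2 (Φ.mulVec w) = A at *
  generalize l2 w = p at *
  generalize l2 z = q at *
  generalize l2 e = ε at *
  have hquad : A ^ 2 ≤ 0.1 * (p * q) + A * ε := by linarith
  have hpA : p ≤ 1.055 * A := abs_le_of_sq_le_sq' (by nlinarith) (by positivity) |>.2
  have hp : p ≤ 0.112 * q + 1.06 * ε := by
    have hA : A ≤ 0.1055 * q + ε := by
      rcases hA0.eq_or_lt with h | h
      · rw [← h]; positivity
      · refine le_of_mul_le_mul_left ?_ h
        nlinarith [mul_le_mul_of_nonneg_right hpA hz0]
    linarith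
  linarith
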